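/- The Lebesgue constant Λ_L of the isotropic sparse-grid interpolation operator of level L in N dimensions, built from nested one-dimensional Clenshaw-Curtis rules with doubling growth m(1)=1, m(l)=2^{l-1}+1, satisfies Λ_L ≤ [(L+1)(L+2)]^N. -/

import Mathlib

open Finset

/-- Number of Clenshaw-Curtis points at level `l`: `m 0 = 0`, `m 1 = 1`, `m l = 2^(l-1)+1`. -/
def ccm (l : ℕ) : ℕ := if l = 0 then 0 else if l = 1 then 1 else 2 ^ (l - 1) + 1

/-- The `j`-th Clenshaw-Curtis abscissa at level `l` (for `j = 0, …, ccm l - 1`). -/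
noncomputable def ccNode (l j : ℕ) : ℝ :=
  if l = 1 then 0 else -Real.cos (Real.pi * j / ((ccm l : ℝ) - 1))

/-- One-dimensional Lagrange basis polynomial at level `l`, node `j`. -/
noncomputable def ccPsi (l j : ℕ) (y : ℝ) : ℝ :=
  ∏ i ∈ (Finset.range (ccm l)).erase j, (y - ccNode l i) / (ccNode l j - ccNode l i)

/-- Tensor-product Lagrange interpolation operator `U^{m(l₁)} ⊗ ⋯ ⊗ U^{m(l_N)}`. -/
noncomputable def tensorU (N : ℕ) (l : Fin N → ℕ) (v : (Fin N → ℝ) → ℝ)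
    (y : Fin N → ℝ) : ℝ :=
  ∑ j ∈ Fintype.piFinset (fun n => Finset.range (ccm (l n))),
    v (fun n => ccNode (l n) (j n)) * ∏ n, ccPsi (l n) (j n) (y n)

/-- Tensorized difference operator `Δ^{m(l₁)} ⊗ ⋯ ⊗ Δ^{m(l_N)}`. -/
noncomputable def tensorDelta (N : ℕ) (l : Fin N → ℕ) (v : (Fin N → ℝ) → ℝ)
    (y : Fin N → ℝ) : ℝ :=
  ∑ i ∈ Fintype.piFinset (fun _ : Fin N => ({0, 1} : Finset ℕ)),
    (-1 : ℝ) ^ (∑ n, i n) * tensorU N (fun n => l n - i n) v y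

/-- Isotropic sparse-grid (Smolyak) interpolation operator of level `L`. -/
noncomputable def sparseI (N L : ℕ) (v : (Fin N → ℝ) → ℝ) (y : Fin N → ℝ) : ℝ :=
  ∑ l ∈ (Fintype.piFinset (fun _ : Fin N => Finset.Icc 1 (L + 1))).filter
      (fun l : Fin N → ℕ => ∑ n, (l n - 1) ≤ L),
    tensorDelta N l v y

/-- The modified Dirichlet kernel `sin (n t) / tan (t / 2)`. -/
noncomputable def trigKernel (n : ℕ) (t : ℝ) : ℝ :=
  ∑ k ∈ range n, (Real.cos (k * t) + Real.cos ((k + 1) * t))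

theorem trigKernel_neg (n : ℕ) (t : ℝ) : trigKernel n (-t) = trigKernel n t := by
  simp [trigKernel]

theorem trigKernel_add_two_pi (n : ℕ) (t : ℝ) :
    trigKernel n (t + 2 * Real.pi) = trigKernel n t := by
  refine sum_congr rfl fun k _ => ?_
  have h := Real.cos_add_nat_mul_two_pi (k * t) k
  have h' := Real.cos_add_nat_mul_two_pi ((k + 1) * t) (k + 1)
  push_cast at h h'
  rw [← h, ← h']
  ring_nf

theorem trigKernel_zero (n : ℕ) : trigKernel n 0 = 2 * n := by
  simp [trigKernel]
  ring

theorem abs_trigKernel_le (n : ℕ) (t : ℝ) : |trigKernel n t| ≤ 2 * n := by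
  refine (abs_sum_le_sum_abs _ _).trans ?_
  refine (sum_le_card_nsmul (range n) _ 2 fun k _ => ?_).trans_eq (by simp [mul_comm])
  have h1 := Real.abs_cos_le_one (k * t)
  have h2 := Real.abs_cos_le_one ((k + 1) * t)
  exact (abs_add_le _ _).trans (by linarith)

theorem trigKernel_mul_sin (n : ℕ) (t : ℝ) :
    trigKernel n t * Real.sin (t / 2) = Real.sin (n * t) * Real.cos (t / 2) := by
  induction n with
  | zero => simp [trigKernel]
  | succ n ih =>
    rw [trigKernel, sum_range_succ, ← trigKernel, add_mul, ih]
    have e : ((n : ℝ) + 1) * t = n * t + (t / 2 + t / 2) := by ring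
    push_cast
    rw [e]
    simp only [Real.sin_add, Real.cos_add]
    linear_combination (Real.cos (n * t) * Real.sin (t / 2)) *
        (Real.sin_sq_add_cos_sq (t / 2)).symm +
      (Real.sin (n * t) * Real.cos (t / 2)) * (Real.sin_sq_add_cos_sq (t / 2)).symm

theorem abs_trigKernel_le_two_div (n : ℕ) {t : ℝ} (h0 : 0 < t) (hpi : t ≤ Real.pi) :
    |trigKernel n t| ≤ 2 / t := by
  have key := congrArg abs (trigKernel_mul_sin n t)
  rw [abs_mul, abs_mul] at key
  have hsin : 0 < Real.sin (t / 2) := Real.sin_pos_of_pos_of_lt_pi (by linarith) (by linarith)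
  rcases hpi.lt_or_eq with hlt | rfl
  · have hcos : 0 < Real.cos (t / 2) :=
      Real.cos_pos_of_mem_Ioo ⟨by linarith, by linarith⟩
    have htan := Real.le_tan (x := t / 2) (by linarith) (by linarith)
    rw [Real.tan_eq_sin_div_cos, le_div_iff₀ hcos] at htan
    rw [abs_of_pos hsin, abs_of_pos hcos] at key
    have h1 := Real.abs_sin_le_one (n * t)
    rw [le_div_iff₀ h0]
    have h2 : |trigKernel n t| * (t / 2 * Real.cos (t / 2)) ≤ Real.cos (t / 2) := by
      refine (mul_le_mul_of_nonneg_left htan (abs_nonneg _)).trans ?_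
      rw [key]
      exact mul_le_of_le_one_left hcos.le h1
    nlinarith
  · simp only [Real.sin_pi_div_two, Real.cos_pi_div_two, abs_zero, mul_zero, abs_one,
      mul_one] at key
    rw [key]
    positivity

theorem trigKernel_eq_zero_of_abs_lt {n : ℕ} (hn : n ≠ 0) {m : ℤ} (hm : m ≠ 0)
    (hlt : |m| < 2 * n) : trigKernel n (Real.pi * m / n) = 0 := by
  have hn' : (n : ℝ) ≠ 0 := by exact_mod_cast hn
  have key := trigKernel_mul_sin n (Real.pi * m / n)
  rw [show (n : ℝ) * (Real.pi * m / n) = m * Real.pi by field_simp, Real.sin_int_mul_pi,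
    zero_mul] at key
  refine (mul_eq_zero.mp key).resolve_right fun h => ?_
  obtain ⟨k, hk⟩ := Real.sin_eq_zero_iff.mp h
  have hk' : (m : ℝ) = k * (2 * n) := by
    have := Real.pi_ne_zero
    field_simp at hk
    linarith
  have hmk : m = k * (2 * n) := by exact_mod_cast hk'
  have hk0 : k ≠ 0 := by
    rintro rfl
    simp_all
  have h1 : 1 ≤ |k| := Int.one_le_abs hk0
  rw [hmk, abs_mul, abs_of_nonneg (by positivity : (0 : ℤ) ≤ 2 * n)] at hlt
  nlinarith

theorem sum_range_add_eq_of_periodic {n : ℕ} {f : ℤ → ℝ} (hf : ∀ m, f (m + n) = f m) (a : ℤ) :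
    ∑ i ∈ range n, f (a + i) = ∑ i ∈ range n, f i := by
  have step (a : ℤ) : ∑ i ∈ range n, f (a + 1 + i) = ∑ i ∈ range n, f (a + i) := by
    have h := (sum_range_succ (fun i : ℕ => f (a + i)) n).symm.trans
      (sum_range_succ' (fun i : ℕ => f (a + i)) n)
    rw [hf] at h
    simp only [Nat.cast_zero, add_zero, add_left_inj] at h
    rw [h]
    exact sum_congr rfl fun i _ => by push_cast; ring_nf
  induction a with
  | zero => simp
  | succ a ih => rw [step, ih]
  | pred a ih => rw [← ih, ← step, sub_add_cancel]

theorem sum_Ico_one_two_pow_inv_le (k : ℕ) : ∑ i ∈ Ico (1 : ℕ) (2 ^ k), (1 / (i : ℝ)) ≤ k := by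
  induction k with
  | zero => simp
  | succ k ih =>
    rw [← sum_Ico_consecutive _ (Nat.one_le_two_pow : 1 ≤ 2 ^ k)
      (Nat.pow_le_pow_right (by norm_num) k.le_succ)]
    have h : ∑ i ∈ Ico (2 ^ k : ℕ) (2 ^ (k + 1)), (1 / (i : ℝ)) ≤ 1 := by
      refine (sum_le_card_nsmul _ _ (1 / 2 ^ k : ℝ) fun i hi => ?_).trans_eq ?_
      · have := (mem_Ico.mp hi).1
        gcongr
        exact_mod_cast this
      · rw [Nat.card_Ico, pow_succ, mul_two, Nat.add_sub_cancel]
        simp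
    push_cast
    linarith

/-- Nearest points first, the translates of the kernel are dominated by a harmonic sum. -/
theorem sum_abs_trigKernel_le {n : ℕ} (hn : n ≠ 0) (θ : ℝ) :
    ∑ i ∈ range (2 * n), |trigKernel n (θ - Real.pi * (i : ℤ) / n)| ≤
      2 * (2 * n + ∑ i ∈ Ico 1 n, 2 * n / Real.pi * (1 / (i : ℝ))) := by
  have hn0 : (0 : ℝ) < n := by exact_mod_cast Nat.pos_of_ne_zero hn
  have hpi := Real.pi_pos
  set f : ℤ → ℝ := fun m => |trigKernel n (θ - Real.pi * m / n)| with hf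
  have hper (m : ℤ) : f (m + (2 * n : ℕ)) = f m := by
    simp only [hf]
    rw [← trigKernel_add_two_pi]
    congr 2
    push_cast
    field_simp
    ring
  set p : ℤ := ⌊n * θ / Real.pi⌋ with hp
  have hp1 : Real.pi * p / n ≤ θ := by
    have := Int.floor_le (n * θ / Real.pi)
    rw [← hp, le_div_iff₀ hpi] at this
    rw [div_le_iff₀ hn0]
    linarith
  have hp2 : θ ≤ Real.pi * (p + 1) / n := by
    have := (Int.lt_floor_add_one (n * θ / Real.pi)).le
    rw [← hp, div_le_iff₀ hpi] at this
    rw [le_div_iff₀ hn0]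
    linarith
  have bound {i : ℕ} (hi : i < n) {t : ℝ} (h1 : Real.pi * i / n ≤ t)
      (h2 : t ≤ Real.pi * (i + 1) / n) :
      |trigKernel n t| ≤ if i = 0 then 2 * (n : ℝ) else 2 * n / Real.pi * (1 / (i : ℝ)) := by
    split_ifs with h
    · exact abs_trigKernel_le n t
    · have hi0 : (0 : ℝ) < i := by exact_mod_cast Nat.pos_of_ne_zero h
      have hpos : 0 < Real.pi * i / n := by positivity
      have hle : t ≤ Real.pi := by
        refine h2.trans ?_
        rw [div_le_iff₀ hn0]
        have : (i : ℝ) + 1 ≤ n := by exact_mod_cast hi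
        gcongr
      refine (abs_trigKernel_le_two_div n (hpos.trans_le h1) hle).trans ?_
      calc 2 / t ≤ 2 / (Real.pi * i / n) := by gcongr
        _ = 2 * n / Real.pi * (1 / (i : ℝ)) := by field_simp
  have hsum : ∑ i ∈ range n, (if i = 0 then 2 * (n : ℝ) else 2 * n / Real.pi * (1 / (i : ℝ))) =
      2 * n + ∑ i ∈ Ico 1 n, 2 * n / Real.pi * (1 / (i : ℝ)) := by
    rw [range_eq_Ico, sum_eq_sum_Ico_succ_bot (Nat.pos_of_ne_zero hn), if_pos rfl]
    congr 1
    refine sum_congr rfl fun i hi => if_neg ?_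
    have := (mem_Ico.mp hi).1
    omega
  change ∑ i ∈ range (2 * n), f i ≤ _
  rw [← sum_range_add_eq_of_periodic hper (p - n + 1), two_mul n, sum_range_add, two_mul (_ + _),
    ← hsum]
  refine add_le_add ?_ ?_
  · rw [← sum_range_reflect]
    refine sum_le_sum fun i hi => ?_
    have hi := mem_range.mp hi
    have e : p - n + 1 + ((n - 1 - i : ℕ) : ℤ) = p - i := by omega
    rw [e]
    refine bound hi ?_ ?_
    · push_cast
      have : Real.pi * (p - i) / n = Real.pi * p / n - Real.pi * i / n := by ring
      linarith
    · push_cast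
      have : Real.pi * (p - i) / n = Real.pi * p / n - Real.pi * i / n := by ring
      have : Real.pi * (p + 1) / n - Real.pi * p / n =
        Real.pi * (i + 1) / n - Real.pi * i / n := by ring
      linarith
  · refine sum_le_sum fun i hi => ?_
    have e : p - n + 1 + ((n + i : ℕ) : ℤ) = p + 1 + i := by push_cast; ring
    rw [e]
    simp only [hf]
    rw [← trigKernel_neg]
    refine bound (mem_range.mp hi) ?_ ?_
    · push_cast
      have : Real.pi * (p + 1 + i) / n = Real.pi * (p + 1) / n + Real.pi * i / n := by ring
      linarith
    · push_cast
      have : Real.pi * (p + 1 + i) / n = Real.pi * p / n + Real.pi * (i + 1) / n := by ring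
      linarith

open Polynomial in
/-- The cardinal polynomials of interpolation at `-cos (π j / n)`, `0 ≤ j ≤ n`, expanded in
Chebyshev polynomials. -/
noncomputable def extremaBasis (n j : ℕ) : ℝ[X] :=
  C (((if j < n then 1 / 2 else 0) + (if 0 < j then 1 / 2 else 0) : ℝ) / n) *
    ∑ k ∈ range n,
      (C (Real.cos (k * (Real.pi - Real.pi * j / n))) * Chebyshev.T ℝ k +
        C (Real.cos ((k + 1) * (Real.pi - Real.pi * j / n))) * Chebyshev.T ℝ (k + 1))

open Polynomial in
theorem eval_extremaBasis (n j : ℕ) (θ : ℝ) :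
    (extremaBasis n j).eval (-Real.cos θ) =
      ((if j < n then 1 / 2 else 0) + (if 0 < j then 1 / 2 else 0)) / (2 * n) *
        (trigKernel n (θ - Real.pi * j / n) + trigKernel n (θ + Real.pi * j / n)) := by
  have h1 : trigKernel n (θ - Real.pi * j / n) =
      trigKernel n ((Real.pi - θ) - (Real.pi - Real.pi * j / n)) := by
    rw [← trigKernel_neg]; congr 1; ring
  have h2 : trigKernel n (θ + Real.pi * j / n) =
      trigKernel n ((Real.pi - θ) + (Real.pi - Real.pi * j / n)) := by
    rw [← trigKernel_neg, ← trigKernel_add_two_pi]; congr 1; ring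
  rw [h1, h2, ← Real.cos_pi_sub, extremaBasis, eval_mul, eval_C, eval_finsetSum]
  set φ := Real.pi - θ
  set ψ := Real.pi - Real.pi * j / n
  have h3 : trigKernel n (φ - ψ) + trigKernel n (φ + ψ) =
      2 * ∑ k ∈ range n, (Real.cos (k * ψ) * Real.cos (k * φ) +
        Real.cos ((k + 1) * ψ) * Real.cos ((k + 1) * φ)) := by
    rw [trigKernel, trigKernel, ← sum_add_distrib, mul_sum]
    refine sum_congr rfl fun k _ => ?_
    simp only [mul_sub, mul_add _ φ ψ, Real.cos_add, Real.cos_sub]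
    ring
  rw [h3]
  have h4 (k : ℕ) : (C (Real.cos (k * ψ)) * Chebyshev.T ℝ k +
        C (Real.cos ((k + 1) * ψ)) * Chebyshev.T ℝ (k + 1)).eval (Real.cos φ) =
      Real.cos (k * ψ) * Real.cos (k * φ) + Real.cos ((k + 1) * ψ) * Real.cos ((k + 1) * φ) := by
    simp [Chebyshev.T_real_cos]
  simp only [h4]
  rw [← mul_assoc]
  congr 1
  ring

open Polynomial in
theorem degree_extremaBasis_lt (n j : ℕ) : (extremaBasis n j).degree < (n + 1 : ℕ) := by
  have hT {k : ℕ} (hk : k ≤ n) (c : ℝ) :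
      (C c * Chebyshev.T ℝ k).degree < (n + 1 : ℕ) := by
    rw [C_mul']
    refine (degree_smul_le _ _).trans_lt ?_
    rw [Chebyshev.degree_T, Int.natAbs_natCast]
    exact_mod_cast Nat.lt_succ_of_le hk
  rw [← mem_degreeLT, extremaBasis, C_mul']
  refine Submodule.smul_mem _ _ (Submodule.sum_mem _ fun k hk => Submodule.add_mem _ ?_ ?_)
  · exact mem_degreeLT.mpr (hT (mem_range.mp hk).le _)
  · exact mem_degreeLT.mpr (mod_cast hT (k := k + 1) (mem_range.mp hk) _)

theorem ccm_of_two_le {l : ℕ} (hl : 2 ≤ l) : ccm l = 2 ^ (l - 1) + 1 := by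
  rw [ccm, if_neg (by omega), if_neg (by omega)]

theorem ccNode_of_two_le {l : ℕ} (hl : 2 ≤ l) (j : ℕ) :
    ccNode l j = -Real.cos (Real.pi * j / (2 ^ (l - 1) : ℕ)) := by
  rw [ccNode, if_neg (by omega), ccm_of_two_le hl]
  push_cast
  rw [add_sub_cancel_right]

theorem ccNode_injOn {l : ℕ} (hl : 2 ≤ l) : Set.InjOn (ccNode l) (range (ccm l)) := by
  intro i hi j hj h
  rw [ccm_of_two_le hl, coe_range, Set.mem_Iio] at hi hj
  rw [ccNode_of_two_le hl, ccNode_of_two_le hl, neg_inj] at h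
  have hn : (0 : ℝ) < (2 ^ (l - 1) : ℕ) := by positivity
  have hmem {i : ℕ} (hi : i < 2 ^ (l - 1) + 1) :
      Real.pi * i / (2 ^ (l - 1) : ℕ) ∈ Set.Icc 0 Real.pi := by
    refine ⟨by positivity, ?_⟩
    rw [div_le_iff₀ hn]
    have : (i : ℝ) ≤ (2 ^ (l - 1) : ℕ) := by exact_mod_cast Nat.le_of_lt_succ hi
    gcongr
  have := Real.injOn_cos (hmem hi) (hmem hj) h
  have hpi := Real.pi_ne_zero
  field_simp at this
  exact_mod_cast this

theorem eval_extremaBasis_node {n i j : ℕ} (hn : n ≠ 0) (hi : i ≤ n) (hj : j ≤ n) :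
    (extremaBasis n j).eval (-Real.cos (Real.pi * i / n)) = if i = j then 1 else 0 := by
  have hn0 : (n : ℝ) ≠ 0 := by exact_mod_cast hn
  have hsub : Real.pi * i / n - Real.pi * j / n = Real.pi * ((i - j : ℤ) : ℝ) / n := by
    push_cast; ring
  have hadd : Real.pi * i / n + Real.pi * j / n = Real.pi * ((i + j : ℤ) : ℝ) / n := by
    push_cast; ring
  rw [eval_extremaBasis]
  rw [hsub, hadd]
  by_cases hij : i = j
  · subst hij
    rw [if_pos (rfl : i = i), sub_self, Int.cast_zero, mul_zero, zero_div, trigKernel_zero]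
    rcases Nat.eq_zero_or_pos i with rfl | hi0
    · rw [if_pos (Nat.pos_of_ne_zero hn), if_neg (lt_irrefl 0)]
      simp only [Nat.cast_zero, add_zero, Int.cast_zero, mul_zero, zero_div, trigKernel_zero]
      field_simp
      norm_num
    rcases hi.lt_or_eq with hlt | rfl
    · rw [if_pos hlt, if_pos hi0, trigKernel_eq_zero_of_abs_lt hn (by omega) (by grind)]
      field_simp
      ring
    · have e : Real.pi * ((i + i : ℤ) : ℝ) / i = 0 + 2 * Real.pi := by
        push_cast; field_simp; ring
      rw [if_neg (lt_irrefl i), if_pos hi0, e, trigKernel_add_two_pi, trigKernel_zero]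
      field_simp
      norm_num
  · rw [if_neg hij, trigKernel_eq_zero_of_abs_lt hn (by omega) (by grind),
      trigKernel_eq_zero_of_abs_lt hn (by omega) (by grind), add_zero, mul_zero]

theorem ccPsi_eq_eval {l j : ℕ} (hl : 2 ≤ l) (hj : j < ccm l) (y : ℝ) :
    ccPsi l j y = (extremaBasis (2 ^ (l - 1)) j).eval y := by
  have hinj := ccNode_injOn hl
  have hj' : j ∈ range (ccm l) := mem_range.mpr hj
  have hcard : #(range (ccm l)) = 2 ^ (l - 1) + 1 := by rw [card_range, ccm_of_two_le hl]
  have hbasis : Lagrange.basis (range (ccm l)) (ccNode l) j =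
      extremaBasis (2 ^ (l - 1)) j := by
    refine Polynomial.eq_of_degrees_lt_of_eval_index_eq _ hinj ?_ ?_ fun i hi => ?_
    · rw [Lagrange.degree_basis hinj hj', hcard]
      exact_mod_cast Nat.lt_succ_self _
    · rw [hcard]
      exact degree_extremaBasis_lt _ _
    · have hi' := mem_range.mp hi
      rw [ccm_of_two_le hl] at hi' hj
      rw [ccNode_of_two_le hl i, eval_extremaBasis_node (by positivity)
        (Nat.le_of_lt_succ hi') (Nat.le_of_lt_succ hj), ← ccNode_of_two_le hl]
      split_ifs with h
      · rw [h, Lagrange.eval_basis_self hinj hj']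
      · exact Lagrange.eval_basis_of_ne (Ne.symm h) hi
  rw [← hbasis, Lagrange.basis, Polynomial.eval_prod, ccPsi]
  refine prod_congr rfl fun i _ => ?_
  simp only [Lagrange.basisDivisor, Polynomial.eval_mul, Polynomial.eval_C,
    Polynomial.eval_sub, Polynomial.eval_X]
  rw [div_eq_inv_mul]

theorem sum_abs_eval_extremaBasis_le {n : ℕ} (hn : n ≠ 0) (θ : ℝ) :
    ∑ j ∈ range (n + 1), |(extremaBasis n j).eval (-Real.cos θ)| ≤
      (∑ i ∈ range (2 * n), |trigKernel n (θ - Real.pi * (i : ℤ) / n)|) / (2 * n) := by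
  have hn0 : (0 : ℝ) < n := by exact_mod_cast Nat.pos_of_ne_zero hn
  set f : ℤ → ℝ := fun m => |trigKernel n (θ - Real.pi * m / n)| with hf
  have hper (m : ℤ) : f (m + (2 * n : ℕ)) = f m := by
    simp only [hf]
    rw [← trigKernel_add_two_pi]
    congr 2
    push_cast
    field_simp
    ring
  have hle (j : ℕ) : |(extremaBasis n j).eval (-Real.cos θ)| ≤
      ((if j < n then f j + f (-j) else 0) + (if 0 < j then f j + f (-j) else 0)) / (4 * n) := by
    have hw : (0 : ℝ) ≤ ((if j < n then 1 / 2 else 0) + (if 0 < j then 1 / 2 else 0)) / (2 * n) := by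
      split_ifs <;> positivity
    rw [eval_extremaBasis, abs_mul, abs_of_nonneg hw]
    refine (mul_le_mul_of_nonneg_left (abs_add_le _ _) hw).trans_eq ?_
    have h1 : |trigKernel n (θ - Real.pi * j / n)| = f j := by simp [hf]
    have h2 : |trigKernel n (θ + Real.pi * j / n)| = f (-j) := by
      simp only [hf]; congr 2; push_cast; ring
    rw [h1, h2]
    split_ifs <;> field_simp <;> ring
  refine (sum_le_sum fun j _ => hle j).trans_eq ?_
  rw [← sum_div, sum_add_distrib, sum_range_succ, if_neg (lt_irrefl n),
    sum_range_succ' (fun j => if 0 < j then f j + f (-j) else 0), if_neg (lt_irrefl 0),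
    sum_congr rfl (fun j hj => if_pos (mem_range.mp hj)),
    sum_congr rfl (fun j _ => if_pos j.succ_pos), sum_add_distrib, sum_add_distrib]
  have hA : ∑ j ∈ range n, f j + ∑ j ∈ range n, f (-(j + 1 : ℕ)) = ∑ i ∈ range (2 * n), f i := by
    rw [← sum_range_add_eq_of_periodic hper (-n), two_mul, sum_range_add, add_comm]
    congr 1
    · rw [← sum_range_reflect]
      refine sum_congr rfl fun i hi => congrArg f ?_
      have := mem_range.mp hi
      omega
    · exact sum_congr rfl fun i _ => congrArg f (by push_cast; ring)
  have hB : ∑ j ∈ range n, f (-j) + ∑ j ∈ range n, f (j + 1 : ℕ) = ∑ i ∈ range (2 * n), f i := by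
    rw [← sum_range_add_eq_of_periodic hper (-n + 1), two_mul, sum_range_add]
    congr 1
    · rw [← sum_range_reflect]
      refine sum_congr rfl fun i hi => congrArg f ?_
      have := mem_range.mp hi
      omega
    · exact sum_congr rfl fun i _ => congrArg f (by push_cast; ring)
  change _ = (∑ i ∈ range (2 * n), f i) / (2 * n)
  rw [div_eq_div_iff (by positivity) (by positivity)]
  linear_combination (2 * (n : ℝ)) * (hA + hB)

/-- An upper bound for the Lebesgue constant of the Clenshaw-Curtis rule of level `l`. -/
noncomputable def ccLebesgueBound (l : ℕ) : ℝ :=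
  if l = 0 then 0 else if l = 1 then 1 else 2 + 2 / 3 * ((l : ℝ) - 1)

theorem sum_abs_ccPsi_le (l : ℕ) {y : ℝ} (hy : y ∈ Set.Icc (-1 : ℝ) 1) :
    ∑ j ∈ range (ccm l), |ccPsi l j y| ≤ ccLebesgueBound l := by
  rcases Nat.lt_or_ge l 2 with hl | hl
  · interval_cases l <;> simp [ccm, ccPsi, ccLebesgueBound]
  have hn : 2 ^ (l - 1) ≠ 0 := by positivity
  set n := 2 ^ (l - 1) with hn_def
  have hn0 : (0 : ℝ) < n := by exact_mod_cast Nat.pos_of_ne_zero hn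
  rw [sum_congr rfl fun j hj => by rw [ccPsi_eq_eval hl (mem_range.mp hj)], ccm_of_two_le hl,
    ← hn_def]
  have hcos : y = -Real.cos (Real.arccos (-y)) := by
    rw [Real.cos_arccos (by linarith [hy.2]) (by linarith [hy.1]), neg_neg]
  have h1 := sum_abs_eval_extremaBasis_le hn (Real.arccos (-y))
  rw [← hcos] at h1
  have h2 := sum_abs_trigKernel_le hn (Real.arccos (-y))
  have h3 := sum_Ico_one_two_pow_inv_le (l - 1)
  rw [← hn_def, Nat.cast_sub (by omega), Nat.cast_one] at h3
  rw [← mul_sum] at h2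
  refine h1.trans ?_
  rw [div_le_iff₀ (by positivity), ccLebesgueBound, if_neg (by omega), if_neg (by omega)]
  refine h2.trans ?_
  have hl1 : (0 : ℝ) ≤ (l : ℝ) - 1 := by
    have : (2 : ℝ) ≤ l := by exact_mod_cast hl
    linarith
  have h4 : 2 * (n : ℝ) / Real.pi * ∑ i ∈ Ico 1 n, (1 / (i : ℝ)) ≤
      2 * n / 3 * ((l : ℝ) - 1) := by
    have := Real.pi_gt_three
    gcongr
  linarith

theorem ccLebesgueBound_nonneg (l : ℕ) : 0 ≤ ccLebesgueBound l := by
  rw [ccLebesgueBound]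
  split_ifs with h0 h1
  · exact le_rfl
  · exact zero_le_one
  · have : (1 : ℝ) ≤ l := by exact_mod_cast Nat.one_le_iff_ne_zero.mpr h0
    linarith

theorem ccLebesgueBound_add_pred_le {l : ℕ} (hl : 1 ≤ l) :
    ccLebesgueBound l + ccLebesgueBound (l - 1) ≤ 2 * l := by
  obtain ⟨k, rfl⟩ := Nat.exists_eq_add_of_le' hl
  rcases k with _ | _ | k
  · norm_num [ccLebesgueBound]
  · norm_num [ccLebesgueBound]
  · have : (0 : ℝ) ≤ k := k.cast_nonneg
    simp [ccLebesgueBound]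
    linarith

theorem abs_tensorU_le {N : ℕ} (l : Fin N → ℕ) {v : (Fin N → ℝ) → ℝ} {M : ℝ} (hM : 0 ≤ M)
    (hv : (∀ n, 1 ≤ l n) → ∀ j : Fin N → ℕ, (∀ n, j n < ccm (l n)) →
      |v (fun n => ccNode (l n) (j n))| ≤ M)
    {y : Fin N → ℝ} (hy : ∀ n, y n ∈ Set.Icc (-1 : ℝ) 1) :
    |tensorU N l v y| ≤ M * ∏ n, ccLebesgueBound (l n) := by
  calc |tensorU N l v y|
      ≤ ∑ j ∈ Fintype.piFinset (fun n => range (ccm (l n))),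
          M * ∏ n, |ccPsi (l n) (j n) (y n)| := by
        refine (abs_sum_le_sum_abs _ _).trans (sum_le_sum fun j hj => ?_)
        rw [abs_mul, abs_prod]
        have hj' (n : Fin N) : j n < ccm (l n) := mem_range.mp (Fintype.mem_piFinset.mp hj n)
        have hl (n : Fin N) : 1 ≤ l n := by
          by_contra! h
          have := hj' n
          simp_all [ccm]
        gcongr
        exact hv hl j hj'
    _ = M * ∏ n, ∑ j ∈ range (ccm (l n)), |ccPsi (l n) j (y n)| := by
        rw [← mul_sum, prod_univ_sum]
    _ ≤ M * ∏ n, ccLebesgueBound (l n) := by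
        gcongr with n
        exact sum_abs_ccPsi_le _ (hy n)

theorem abs_tensorDelta_le {N : ℕ} {l : Fin N → ℕ} (hl : ∀ n, 1 ≤ l n)
    {v : (Fin N → ℝ) → ℝ} {M : ℝ} (hM : 0 ≤ M)
    (hv : ∀ l' : Fin N → ℕ, (∀ n, 1 ≤ l' n ∧ l' n ≤ l n) →
      ∀ j : Fin N → ℕ, (∀ n, j n < ccm (l' n)) → |v (fun n => ccNode (l' n) (j n))| ≤ M)
    {y : Fin N → ℝ} (hy : ∀ n, y n ∈ Set.Icc (-1 : ℝ) 1) :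
    |tensorDelta N l v y| ≤ M * ∏ n, (2 * (l n : ℝ)) := by
  calc |tensorDelta N l v y|
      ≤ ∑ i ∈ Fintype.piFinset (fun _ : Fin N => ({0, 1} : Finset ℕ)),
          M * ∏ n, ccLebesgueBound (l n - i n) := by
        refine (abs_sum_le_sum_abs _ _).trans (sum_le_sum fun i _ => ?_)
        rw [abs_mul, abs_pow, abs_neg, abs_one, one_pow, one_mul]
        exact abs_tensorU_le _ hM
          (fun h => hv _ fun n => ⟨h n, Nat.sub_le _ _⟩) hy
    _ = M * ∏ n, (ccLebesgueBound (l n) + ccLebesgueBound (l n - 1)) := by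
        rw [← mul_sum, ← prod_univ_sum (f := fun n i => ccLebesgueBound (l n - i))]
        simp
    _ ≤ M * ∏ n, (2 * (l n : ℝ)) := by
        gcongr with n
        · exact fun n _ => add_nonneg (ccLebesgueBound_nonneg _) (ccLebesgueBound_nonneg _)
        · exact ccLebesgueBound_add_pred_le (hl n)

theorem sum_Icc_two_mul (L : ℕ) :
    ∑ l ∈ Icc 1 (L + 1), (2 * (l : ℝ)) = ((L : ℝ) + 1) * ((L : ℝ) + 2) := by
  induction L with
  | zero => norm_num
  | succ L ih =>
    rw [sum_Icc_succ_top (by omega), ih]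
    push_cast
    ring

/-- Lebesgue constant bound for the isotropic Clenshaw-Curtis sparse grid:
if `|v| ≤ M` at every sparse-grid point, then `|I_L[v](y)| ≤ ((L+1)(L+2))^N · M`
for every `y ∈ [-1,1]^N`. -/
theorem sparse_grid_lebesgue_bound (N L : ℕ) (hN : 1 ≤ N)
    (v : (Fin N → ℝ) → ℝ) (M : ℝ)
    (hv : ∀ l : Fin N → ℕ, (∀ n, 1 ≤ l n ∧ l n ≤ L + 1) → (∑ n, (l n - 1)) ≤ L →
      ∀ j : Fin N → ℕ, (∀ n, j n < ccm (l n)) →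
        |v (fun n => ccNode (l n) (j n))| ≤ M)
    (y : Fin N → ℝ) (hy : ∀ n, y n ∈ Set.Icc (-1 : ℝ) 1) :
    |sparseI N L v y| ≤ (((L : ℝ) + 1) * ((L : ℝ) + 2)) ^ N * M := by
  have hM : 0 ≤ M := (abs_nonneg _).trans
    (hv (fun _ => 1) (fun _ => ⟨le_rfl, by omega⟩) (by simp) (fun _ => 0) (by simp [ccm]))
  calc |sparseI N L v y|
      ≤ ∑ l ∈ (Fintype.piFinset (fun _ : Fin N => Finset.Icc 1 (L + 1))).filter
          (fun l : Fin N → ℕ => ∑ n, (l n - 1) ≤ L), M * ∏ n, (2 * (l n : ℝ)) := by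
        refine (abs_sum_le_sum_abs _ _).trans (sum_le_sum fun l hl => ?_)
        obtain ⟨hl, hL⟩ := mem_filter.mp hl
        have hl' (n : Fin N) := mem_Icc.mp (Fintype.mem_piFinset.mp hl n)
        refine abs_tensorDelta_le (fun n => (hl' n).1) hM (fun l' h => hv l' ?_ ?_) hy
        · exact fun n => ⟨(h n).1, (h n).2.trans (hl' n).2⟩
        · exact (sum_le_sum fun n _ => Nat.sub_le_sub_right (h n).2 1).trans hL
    _ ≤ ∑ l ∈ Fintype.piFinset (fun _ : Fin N => Finset.Icc 1 (L + 1)),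
          M * ∏ n, (2 * (l n : ℝ)) :=
        sum_le_sum_of_subset_of_nonneg (filter_subset _ _) fun _ _ _ => by positivity
    _ = (((L : ℝ) + 1) * ((L : ℝ) + 2)) ^ N * M := by
        rw [← mul_sum, ← prod_univ_sum (f := fun _ (l : ℕ) => 2 * (l : ℝ)), mul_comm]
        simp [sum_Icc_two_mul]
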